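/- Under the setup of the context (in particular Σ_{t,g,ℓ} P(t, ℓ, g | τ) ≤ 1 for every size-d0 subset τ, and 0 < Q_min · (d0/d1) · σ_min(Ã)² ≤ 1), consider the distributed randomized Kaczmarz process started at x_0 ∈ ℝ^{d2}: at each step, given the current iterate x, a size-d0 subset τ ⊆ [d1] is chosen with probability 1/C(d1, d0); then with probability P(t, ℓ, g | τ) the next iterate is x − ((⟨A_t, x⟩ − (b_t + e_{t,ℓ})) / ‖A_t‖₂²) A_tᵀ, and with the remaining probability 1 − Σ_{t,g,ℓ} P(t, ℓ, g | τ) the iterate is unchanged. Then the expected squared error after i steps (i.e. the finite weighted sum over all length-i decision paths, each path weighted by the product of its per-step probabilities, of the squared distance of the resulting iterate to x*) satisfies E‖x_i − x*‖₂² ≤ α^i · ‖x_0 − x*‖₂² + ((1 − α^{i+1})/(1 − α)) · Σ_{t∈[d1]} β_t · ‖ẽ_t‖₂², where α = 1 − Q_min · (d0/d1) · σ_min(Ã)². -/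

import Mathlib

open Finset Polynomial

/-- `∑_{j=0}^{g−1} C(mc, j) x^j`. -/
noncomputable def catPoly (mc g : ℕ) : Polynomial ℕ :=
  ∑ j ∈ Finset.range g, Polynomial.C (mc.choose j) * Polynomial.X ^ j

/-- `a^t_{g,ℓ}`: coefficient of `x^{n−g}` in `∏_{ℓ'≠ℓ} (∑_{j=0}^{g−1} C(m ℓ', j) x^j)`. -/
noncomputable def aCoeff (k : ℕ) (m : Fin (k + 1) → ℕ) (n g : ℕ) (ℓ : Fin (k + 1)) : ℕ :=
  (∏ ℓ' ∈ Finset.univ.erase ℓ, catPoly (m ℓ') g).coeff (n - g)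

/-- `b^s_g`: coefficient of `x^n` in `∏_{ℓ=0}^{k} (∑_{j=0}^{g−1} C(m ℓ, j) x^j)`. -/
noncomputable def bCoeff (k : ℕ) (m : Fin (k + 1) → ℕ) (n g : ℕ) : ℕ :=
  (∏ ℓ : Fin (k + 1), catPoly (m ℓ) g).coeff n

/-- `P(t, ℓ, g | τ) = [C(m t ℓ, g)·a^t_{g,ℓ}/C(N t, n t)]·∏_{s∈τ\{t}} b^s_g/C(N s, n s)`. -/
noncomputable def Pfun {ι : Type*} [DecidableEq ι] (k : ℕ) (N n : ι → ℕ)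
    (m : ι → Fin (k + 1) → ℕ) (t : ι) (ℓ : Fin (k + 1)) (g : ℕ) (τ : Finset ι) : ℝ :=
  (((m t ℓ).choose g * aCoeff k (m t) (n t) g ℓ : ℕ) : ℝ) / ((N t).choose (n t) : ℝ) *
    ∏ s ∈ τ.erase t, ((bCoeff k (m s) (n s) g : ℕ) : ℝ) / ((N s).choose (n s) : ℝ)

/-- `P(t, g | τ) = ∑_ℓ P(t, ℓ, g | τ)`. -/
noncomputable def Pmode {ι : Type*} [DecidableEq ι] (k : ℕ) (N n : ι → ℕ)
    (m : ι → Fin (k + 1) → ℕ) (t : ι) (g : ℕ) (τ : Finset ι) : ℝ :=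
  ∑ ℓ : Fin (k + 1), Pfun k N n m t ℓ g τ

/-- Minimal mode number `g₀(t) = max(⌈n t/(k+1)⌉, ⌈n t · m t 0 / N t⌉)`. -/
noncomputable def gZero {ι : Type*} (k : ℕ) (N n : ι → ℕ)
    (m : ι → Fin (k + 1) → ℕ) (t : ι) : ℕ :=
  max ⌈(n t : ℚ) / (k + 1)⌉₊ ⌈(n t * m t 0 : ℚ) / (N t : ℚ)⌉₊

/-- `Q_max(t, g, τ') = (max_ℓ C(m t ℓ, g)·a^t_{g,ℓ}/C(N t, n t))·∏_{s∈τ'} b^s_g/C(N s, n s)`. -/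
noncomputable def Qmax {ι : Type*} [DecidableEq ι] (k : ℕ) (N n : ι → ℕ)
    (m : ι → Fin (k + 1) → ℕ) (t : ι) (g : ℕ) (τ' : Finset ι) : ℝ :=
  (Finset.univ.sup' ⟨0, Finset.mem_univ 0⟩ fun ℓ : Fin (k + 1) =>
      (((m t ℓ).choose g * aCoeff k (m t) (n t) g ℓ : ℕ) : ℝ) / ((N t).choose (n t) : ℝ)) *
    ∏ s ∈ τ', ((bCoeff k (m s) (n s) g : ℕ) : ℝ) / ((N s).choose (n s) : ℝ)

/-- `Q_min`: the minimum over size-`d0` subsets `τ ⊆ [d1]` and `t ∈ τ` of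
`∑_{g=g₀(t)}^{n t} P(t, g | τ)`. -/
noncomputable def Qmin (d1 k d0 : ℕ) (N n : Fin d1 → ℕ) (m : Fin d1 → Fin (k + 1) → ℕ) : ℝ :=
  sInf {x : ℝ | ∃ τ ∈ Finset.powersetCard d0 (Finset.univ : Finset (Fin d1)), ∃ t ∈ τ,
    x = ∑ g ∈ Finset.Icc (gZero k N n m t) (n t), Pmode k N n m t g τ}

/-- `β_t = ∑_{τ' ⊆ [d1]\{t}, |τ'| = d0−1} ∑_{g=g₀(t)}^{n t} (1/C(d1, d0))·Q_max(t, g, τ')`. -/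
noncomputable def betaCoef (d1 k d0 : ℕ) (N n : Fin d1 → ℕ)
    (m : Fin d1 → Fin (k + 1) → ℕ) (t : Fin d1) : ℝ :=
  ∑ τ' ∈ Finset.powersetCard (d0 - 1) ((Finset.univ : Finset (Fin d1)).erase t),
    ∑ g ∈ Finset.Icc (gZero k N n m t) (n t), (1 / (d1.choose d0 : ℝ)) * Qmax k N n m t g τ'

/-- The smallest singular value of `M`: the largest `σ ≥ 0` with `‖My‖₂ ≥ σ‖y‖₂` for all `y`. -/
noncomputable def sigmaMin {d1 d2 : ℕ} (M : Matrix (Fin d1) (Fin d2) ℝ) : ℝ :=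
  sSup {σ : ℝ | 0 ≤ σ ∧ ∀ y : Fin d2 → ℝ,
    σ * Real.sqrt (∑ i, y i ^ 2) ≤ Real.sqrt (∑ i, (∑ j, M i j * y j) ^ 2)}

lemma Pfun_nonneg {ι : Type*} [DecidableEq ι] (k : ℕ) (N n : ι → ℕ)
    (m : ι → Fin (k + 1) → ℕ) (t : ι) (ℓ : Fin (k + 1)) (g : ℕ) (τ : Finset ι) :
    0 ≤ Pfun k N n m t ℓ g τ := by
  unfold Pfun
  positivity

lemma Pfun_le_Qmax {ι : Type*} [DecidableEq ι] (k : ℕ) (N n : ι → ℕ)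
    (m : ι → Fin (k + 1) → ℕ) (t : ι) (ℓ : Fin (k + 1)) (g : ℕ) (τ : Finset ι) :
    Pfun k N n m t ℓ g τ ≤ Qmax k N n m t g (τ.erase t) := by
  unfold Pfun Qmax
  refine mul_le_mul_of_nonneg_right ?_ (by positivity)
  exact Finset.le_sup' (fun ℓ : Fin (k + 1) =>
    (((m t ℓ).choose g * aCoeff k (m t) (n t) g ℓ : ℕ) : ℝ) / ((N t).choose (n t) : ℝ))
    (Finset.mem_univ ℓ)

lemma Qmax_nonneg {ι : Type*} [DecidableEq ι] (k : ℕ) (N n : ι → ℕ)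
    (m : ι → Fin (k + 1) → ℕ) (t : ι) (g : ℕ) (τ : Finset ι) :
    0 ≤ Qmax k N n m t g τ := by
  unfold Qmax
  refine mul_nonneg ?_ (by positivity)
  refine le_trans ?_ (Finset.le_sup' _ (Finset.mem_univ (0 : Fin (k + 1))))
  positivity

lemma betaCoef_nonneg (d1 k d0 : ℕ) (N n : Fin d1 → ℕ) (m : Fin d1 → Fin (k + 1) → ℕ)
    (t : Fin d1) : 0 ≤ betaCoef d1 k d0 N n m t :=
  Finset.sum_nonneg fun _ _ => Finset.sum_nonneg fun _ _ =>
    mul_nonneg (by positivity) (Qmax_nonneg ..)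

lemma sum_Pfun_nonneg {ι : Type*} [DecidableEq ι] (k : ℕ) (N n : ι → ℕ)
    (m : ι → Fin (k + 1) → ℕ) (t : ι) (τ : Finset ι) :
    0 ≤ ∑ g ∈ Finset.Icc (gZero k N n m t) (n t), ∑ ℓ : Fin (k + 1), Pfun k N n m t ℓ g τ :=
  Finset.sum_nonneg fun _ _ => Finset.sum_nonneg fun _ _ => Pfun_nonneg ..

lemma Qmin_nonneg (d1 k d0 : ℕ) (N n : Fin d1 → ℕ) (m : Fin d1 → Fin (k + 1) → ℕ) :
    0 ≤ Qmin d1 k d0 N n m := by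
  refine Real.sInf_nonneg ?_
  rintro _ ⟨τ, -, t, -, rfl⟩
  exact sum_Pfun_nonneg ..

lemma Qmin_le {d1 k d0 : ℕ} {N n : Fin d1 → ℕ} {m : Fin d1 → Fin (k + 1) → ℕ}
    {τ : Finset (Fin d1)} (hτ : τ ∈ Finset.powersetCard d0 Finset.univ) {t : Fin d1}
    (ht : t ∈ τ) :
    Qmin d1 k d0 N n m ≤
      ∑ g ∈ Finset.Icc (gZero k N n m t) (n t), ∑ ℓ : Fin (k + 1), Pfun k N n m t ℓ g τ := by
  refine csInf_le ⟨0, ?_⟩ ⟨τ, hτ, t, ht, rfl⟩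
  rintro _ ⟨τ, -, t, -, rfl⟩
  exact sum_Pfun_nonneg ..

lemma sigmaMin_sq_mul_le {d1 d2 : ℕ} (M : Matrix (Fin d1) (Fin d2) ℝ) (y : Fin d2 → ℝ) :
    sigmaMin M ^ 2 * ∑ j, y j ^ 2 ≤ ∑ i, (∑ j, M i j * y j) ^ 2 := by
  have hy : 0 ≤ ∑ j, y j ^ 2 := by positivity
  have hM : 0 ≤ ∑ i, (∑ j, M i j * y j) ^ 2 := by positivity
  rcases hy.eq_or_lt with h | h
  · rwa [← h, mul_zero]
  have hpos := Real.sqrt_pos.2 h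
  have h0 : 0 ≤ sigmaMin M := Real.sSup_nonneg fun σ hσ => hσ.1
  have hle : sigmaMin M ≤ √(∑ i, (∑ j, M i j * y j) ^ 2) / √(∑ j, y j ^ 2) := by
    refine csSup_le ⟨0, le_rfl, fun z => by simp⟩ fun σ hσ => ?_
    exact (le_div_iff₀ hpos).2 (hσ.2 y)
  rw [le_div_iff₀ hpos] at hle
  have := pow_le_pow_left₀ (by positivity) hle 2
  rwa [mul_pow, Real.sq_sqrt hy, Real.sq_sqrt hM] at this

/-- Double counting pairs `t ∈ τ`: each `τ ∋ t` is `insert t τ'` for a unique `τ' ∌ t`. -/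
lemma sum_powersetCard_sum_erase {ι : Type*} [Fintype ι] [DecidableEq ι] {d : ℕ} (hd : 1 ≤ d)
    (f : ι → Finset ι → ℝ) :
    ∑ τ ∈ Finset.powersetCard d (Finset.univ : Finset ι), ∑ t ∈ τ, f t (τ.erase t) =
      ∑ t, ∑ τ' ∈ Finset.powersetCard (d - 1) ((Finset.univ : Finset ι).erase t), f t τ' := by
  rw [Finset.sum_sigma', Finset.sum_sigma']
  refine Finset.sum_bij' (fun p _ => ⟨p.2, p.1.erase p.2⟩) (fun p _ => ⟨insert p.1 p.2, p.1⟩)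
    ?_ ?_ ?_ ?_ ?_
  · rintro ⟨τ, t⟩ h
    simp only [Finset.mem_sigma, Finset.mem_powersetCard, Finset.mem_univ, true_and] at h ⊢
    exact ⟨Finset.erase_subset_erase _ (Finset.subset_univ _),
      by rw [Finset.card_erase_of_mem h.2, h.1.2]⟩
  · rintro ⟨t, τ'⟩ h
    simp only [Finset.mem_sigma, Finset.mem_powersetCard, Finset.mem_univ, true_and] at h ⊢
    have ht : t ∉ τ' := fun hmem => Finset.notMem_erase t _ (h.1 hmem)
    exact ⟨⟨Finset.subset_univ _, by rw [Finset.card_insert_of_notMem ht]; omega⟩,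
      Finset.mem_insert_self _ _⟩
  · rintro ⟨τ, t⟩ h
    simp only [Finset.mem_sigma] at h
    simp [Finset.insert_erase h.2]
  · rintro ⟨t, τ'⟩ h
    simp only [Finset.mem_sigma, Finset.mem_powersetCard] at h
    have ht : t ∉ τ' := fun hmem => Finset.notMem_erase t _ (h.2.1 hmem)
    simp [Finset.erase_insert ht]
  · rintro ⟨τ, t⟩ _
    rfl

/-- The average over `d`-subsets of a sum over the subset is `d / |ι|` times the full sum. -/
lemma average_powersetCard_sum {n d : ℕ} (hd : 1 ≤ d) (hdn : d ≤ n) (f : Fin n → ℝ) :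
    (1 / (n.choose d : ℝ)) *
      ∑ τ ∈ Finset.powersetCard d (Finset.univ : Finset (Fin n)), ∑ t ∈ τ, f t =
      (d : ℝ) / n * ∑ t, f t := by
  rw [sum_powersetCard_sum_erase hd fun t _ => f t]
  simp only [Finset.sum_const, Finset.card_powersetCard, Finset.card_erase_of_mem,
    Finset.mem_univ, Finset.card_univ, Fintype.card_fin, nsmul_eq_mul, ← Finset.mul_sum]
  obtain ⟨d, rfl⟩ := Nat.exists_eq_add_of_le' hd
  obtain ⟨n, rfl⟩ := Nat.exists_eq_add_of_le' (hd.trans hdn)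
  have hpos : ((n + 1).choose (d + 1) : ℝ) ≠ 0 := by
    exact_mod_cast (Nat.choose_pos hdn).ne'
  have h : ((n : ℝ) + 1) * n.choose d = (n + 1).choose (d + 1) * (d + 1) := by
    exact_mod_cast Nat.add_one_mul_choose_eq n d
  simp only [Nat.add_sub_cancel]
  push_cast
  field_simp
  linear_combination (∑ t, f t) * h

/-- Squared distance to the solution after a Kaczmarz projection with right-hand-side error `ε`. -/
lemma kaczmarz_step {d : ℕ} (a x xs : Fin d → ℝ) (ha : ∑ j, a j ^ 2 ≠ 0) (ε : ℝ) :
    ∑ j, (x j - ((∑ j', a j' * x j') - ((∑ j', a j' * xs j') + ε)) / (∑ j', a j' ^ 2) * a j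
        - xs j) ^ 2 =
      ∑ j, (x j - xs j) ^ 2 - (∑ j, a j * (x j - xs j)) ^ 2 / (∑ j, a j ^ 2)
        + ε ^ 2 / (∑ j, a j ^ 2) := by
  have hr : (∑ j', a j' * x j') - ((∑ j', a j' * xs j') + ε) =
      ∑ j, a j * (x j - xs j) - ε := by
    simp only [mul_sub, Finset.sum_sub_distrib]
    ring
  have hexp : ∀ c : ℝ, ∑ j, (x j - c * a j - xs j) ^ 2 =
      ∑ j, (x j - xs j) ^ 2 - 2 * c * ∑ j, a j * (x j - xs j) + c ^ 2 * ∑ j, a j ^ 2 := by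
    intro c
    simp only [Finset.mul_sum, ← Finset.sum_sub_distrib, ← Finset.sum_add_distrib]
    exact Finset.sum_congr rfl fun j _ => by ring
  rw [hr, hexp]
  field_simp
  ring

/-- Iterating a one-step contraction estimate `T F ≤ α F + B` for a monotone operator `T` that
commutes with affine maps. -/
lemma iterate_le_of_step {X : Type*} {T : (X → ℝ) → X → ℝ} {F : X → ℝ} {α B : ℝ} (hα : 0 ≤ α)
    (hmono : ∀ φ ψ : X → ℝ, (∀ x, φ x ≤ ψ x) → ∀ x, T φ x ≤ T ψ x)
    (haff : ∀ (c d : ℝ) x, T (fun y => c * F y + d) x = c * T F x + d)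
    (hstep : ∀ x, T F x ≤ α * F x + B) (i : ℕ) (x : X) :
    T^[i] F x ≤ α ^ i * F x + (∑ j ∈ Finset.range i, α ^ j) * B := by
  induction i generalizing x with
  | zero => simp
  | succ i ih =>
    rw [Function.iterate_succ_apply']
    refine (hmono _ _ ih x).trans ?_
    rw [haff, Finset.sum_range_succ, pow_succ]
    nlinarith [mul_le_mul_of_nonneg_left (hstep x) (pow_nonneg hα i)]

/-- The weighted contribution of the errors is bounded through the coefficients `β_t`. -/
lemma error_le_betaCoef {d1 k d0 : ℕ} (hd0 : 1 ≤ d0) (N n : Fin d1 → ℕ)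
    (m : Fin d1 → Fin (k + 1) → ℕ) (w : Fin d1 → Fin (k + 1) → ℝ) (hw : ∀ t ℓ, 0 ≤ w t ℓ) :
    (1 / (d1.choose d0 : ℝ)) *
      ∑ τ ∈ Finset.powersetCard d0 (Finset.univ : Finset (Fin d1)), ∑ t ∈ τ,
        ∑ g ∈ Finset.Icc (gZero k N n m t) (n t), ∑ ℓ : Fin (k + 1),
          Pfun k N n m t ℓ g τ * w t ℓ ≤
      ∑ t, betaCoef d1 k d0 N n m t * ∑ ℓ, w t ℓ := by
  calc
    _ ≤ (1 / (d1.choose d0 : ℝ)) *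
      ∑ τ ∈ Finset.powersetCard d0 (Finset.univ : Finset (Fin d1)), ∑ t ∈ τ,
        ∑ g ∈ Finset.Icc (gZero k N n m t) (n t), ∑ ℓ : Fin (k + 1),
          Qmax k N n m t g (τ.erase t) * w t ℓ := by
      gcongr with τ _ t _ g _ ℓ _
      · exact hw t ℓ
      · exact Pfun_le_Qmax ..
    _ = _ := by
      rw [sum_powersetCard_sum_erase hd0 fun t τ' =>
        ∑ g ∈ Finset.Icc (gZero k N n m t) (n t), ∑ ℓ : Fin (k + 1), Qmax k N n m t g τ' * w t ℓ]
      simp only [betaCoef, ← Finset.mul_sum, ← Finset.sum_mul, mul_assoc]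

/-- Convergence of the distributed randomized Kaczmarz process
without block-list (Theorem 3.5).  The expected squared error after `i` steps —
encoded via the one-step conditional-expectation operator `T` on functions of the
iterate, so that `T^[i] (fun x => ‖x − x*‖₂²) x0` is exactly the finite weighted sum
over all length-`i` decision paths (each weighted by the product of its per-step
probabilities) of the squared distance of the resulting iterate to `x*` — satisfies
`E‖x_i − x*‖₂² ≤ α^i·‖x_0 − x*‖₂² + ((1 − α^{i+1})/(1 − α))·∑_t β_t·‖ẽ_t‖₂²`
with `α = 1 − Q_min·(d0/d1)·σ_min(Ã)²`. -/
theorem stmt_12 (d1 d2 k d0 : ℕ) (hd0 : 1 ≤ d0) (hd0' : d0 ≤ d1) (hd12 : d2 ≤ d1)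
    (A : Matrix (Fin d1) (Fin d2) ℝ) (hA : ∀ t, ∑ j, A t j ^ 2 ≠ 0)
    (Atil : Matrix (Fin d1) (Fin d2) ℝ)
    (hAtil : ∀ t j, Atil t j = A t j / Real.sqrt (∑ j', A t j' ^ 2))
    (b : Fin d1 → ℝ) (xstar : Fin d2 → ℝ)
    (hsol : ∀ t, ∑ j, A t j * xstar j = b t)
    (N n : Fin d1 → ℕ) (m : Fin d1 → Fin (k + 1) → ℕ)
    (hnN : ∀ r, n r ≤ N r) (hmN : ∀ r, ∑ ℓ, m r ℓ = N r)
    (e : Fin d1 → Fin (k + 1) → ℝ) (he0 : ∀ t, e t 0 = 0)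
    (hPsum : ∀ τ ∈ Finset.powersetCard d0 (Finset.univ : Finset (Fin d1)),
      (∑ t ∈ τ, ∑ g ∈ Finset.Icc (gZero k N n m t) (n t), ∑ ℓ : Fin (k + 1),
        Pfun k N n m t ℓ g τ) ≤ 1)
    (hαpos : 0 < Qmin d1 k d0 N n m * ((d0 : ℝ) / (d1 : ℝ)) * sigmaMin Atil ^ 2)
    (hα1 : Qmin d1 k d0 N n m * ((d0 : ℝ) / (d1 : ℝ)) * sigmaMin Atil ^ 2 ≤ 1)
    (T : ((Fin d2 → ℝ) → ℝ) → ((Fin d2 → ℝ) → ℝ))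
    (hT : ∀ φ x, T φ x = (1 / (d1.choose d0 : ℝ)) *
        ∑ τ ∈ Finset.powersetCard d0 (Finset.univ : Finset (Fin d1)),
          ((1 - ∑ t ∈ τ, ∑ g ∈ Finset.Icc (gZero k N n m t) (n t), ∑ ℓ : Fin (k + 1),
                Pfun k N n m t ℓ g τ) * φ x
            + ∑ t ∈ τ, ∑ g ∈ Finset.Icc (gZero k N n m t) (n t), ∑ ℓ : Fin (k + 1),
                Pfun k N n m t ℓ g τ *
                  φ (fun j => x j -
                      ((∑ j', A t j' * x j') - (b t + e t ℓ)) / (∑ j', A t j' ^ 2) * A t j)))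
    (i : ℕ) (x0 : Fin d2 → ℝ) :
    T^[i] (fun x => ∑ j, (x j - xstar j) ^ 2) x0
      ≤ (1 - Qmin d1 k d0 N n m * ((d0 : ℝ) / (d1 : ℝ)) * sigmaMin Atil ^ 2) ^ i *
            ∑ j, (x0 j - xstar j) ^ 2
          + ((1 - (1 - Qmin d1 k d0 N n m * ((d0 : ℝ) / (d1 : ℝ)) * sigmaMin Atil ^ 2) ^ (i + 1))
              / (1 - (1 - Qmin d1 k d0 N n m * ((d0 : ℝ) / (d1 : ℝ)) * sigmaMin Atil ^ 2))) *
            ∑ t, betaCoef d1 k d0 N n m t *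
              (∑ ℓ : Fin (k + 1), e t ℓ ^ 2 / (∑ j, A t j ^ 2)) := by
  have hsum (t : Fin d1) : 0 < ∑ j, A t j ^ 2 := (hA t).symm.lt_of_le (by positivity)
  set Q := Qmin d1 k d0 N n m
  set σ := sigmaMin Atil
  set α := 1 - Q * ((d0 : ℝ) / (d1 : ℝ)) * σ ^ 2 with hα
  set B := ∑ t, betaCoef d1 k d0 N n m t * (∑ ℓ : Fin (k + 1), e t ℓ ^ 2 / (∑ j, A t j ^ 2))
  have hα0 : 0 ≤ α := by linarith
  have hα1 : α < 1 := by linarith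
  have hB : 0 ≤ B := Finset.sum_nonneg fun t _ => mul_nonneg (betaCoef_nonneg ..)
    (Finset.sum_nonneg fun ℓ _ => div_nonneg (sq_nonneg _) (hsum t).le)
  have hC : (d1.choose d0 : ℝ) ≠ 0 := by exact_mod_cast (Nat.choose_pos hd0').ne'
  have hav (c : ℝ) : (1 / (d1.choose d0 : ℝ)) *
      ∑ τ ∈ Finset.powersetCard d0 (Finset.univ : Finset (Fin d1)), c = c := by
    simp only [Finset.sum_const, Finset.card_powersetCard, Finset.card_univ, Fintype.card_fin,
      nsmul_eq_mul]
    field_simp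
  have hmono (φ ψ : (Fin d2 → ℝ) → ℝ) (h : ∀ x, φ x ≤ ψ x) (x) : T φ x ≤ T ψ x := by
    rw [hT, hT]
    gcongr with τ hτ t _ g _ ℓ _
    · exact sub_nonneg.2 (hPsum τ hτ)
    · exact h x
    · exact Pfun_nonneg ..
    · exact h _
  have haff (φ : (Fin d2 → ℝ) → ℝ) (c d : ℝ) (x) :
      T (fun y => c * φ y + d) x = c * T φ x + d := by
    rw [hT, hT]
    conv_rhs =>
      rw [← hav d, mul_left_comm c, ← mul_add, Finset.mul_sum, ← Finset.sum_add_distrib]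
    congr 1
    refine Finset.sum_congr rfl fun τ _ => ?_
    simp only [mul_add, Finset.sum_add_distrib, mul_left_comm _ c, ← Finset.mul_sum,
      ← Finset.sum_mul]
    ring
  have hstep (x : Fin d2 → ℝ) : T (fun x => ∑ j, (x j - xstar j) ^ 2) x ≤
      α * ∑ j, (x j - xstar j) ^ 2 + B := by
    set F := ∑ j, (x j - xstar j) ^ 2
    set ρ : Fin d1 → ℝ := fun t => (∑ j, A t j * (x j - xstar j)) ^ 2 / (∑ j, A t j ^ 2)
    have hρ (t) : 0 ≤ ρ t := div_nonneg (sq_nonneg _) (hsum t).le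
    have hσ : σ ^ 2 * F ≤ ∑ t, ρ t := by
      refine (sigmaMin_sq_mul_le Atil fun j => x j - xstar j).trans_eq
        (Finset.sum_congr rfl fun t _ => ?_)
      simp only [hAtil, div_mul_eq_mul_div, ← Finset.sum_div, div_pow,
        Real.sq_sqrt (hsum t).le, ρ]
    have hτ (τ) (hτ : τ ∈ Finset.powersetCard d0 (Finset.univ : Finset (Fin d1))) :
        (1 - ∑ t ∈ τ, ∑ g ∈ Finset.Icc (gZero k N n m t) (n t), ∑ ℓ : Fin (k + 1),
            Pfun k N n m t ℓ g τ) * F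
          + ∑ t ∈ τ, ∑ g ∈ Finset.Icc (gZero k N n m t) (n t), ∑ ℓ : Fin (k + 1),
            Pfun k N n m t ℓ g τ * (F - ρ t + e t ℓ ^ 2 / (∑ j, A t j ^ 2)) ≤
        F - Q * ∑ t ∈ τ, ρ t + ∑ t ∈ τ, ∑ g ∈ Finset.Icc (gZero k N n m t) (n t),
          ∑ ℓ : Fin (k + 1), Pfun k N n m t ℓ g τ * (e t ℓ ^ 2 / (∑ j, A t j ^ 2)) := by
      have h : Q * ∑ t ∈ τ, ρ t ≤ ∑ t ∈ τ, (∑ g ∈ Finset.Icc (gZero k N n m t) (n t),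
          ∑ ℓ : Fin (k + 1), Pfun k N n m t ℓ g τ) * ρ t := by
        rw [Finset.mul_sum]
        exact Finset.sum_le_sum fun t ht => mul_le_mul_of_nonneg_right (Qmin_le hτ ht) (hρ t)
      simp only [mul_add, mul_sub, Finset.sum_add_distrib, Finset.sum_sub_distrib,
        ← Finset.sum_mul]
      linarith
    rw [hT]
    simp only [← hsol, kaczmarz_step _ _ _ (hA _)]
    refine (mul_le_mul_of_nonneg_left (Finset.sum_le_sum hτ) (by positivity)).trans ?_
    rw [Finset.sum_add_distrib, Finset.sum_sub_distrib, mul_add, mul_sub, hav, ← Finset.mul_sum,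
      mul_left_comm, average_powersetCard_sum hd0 hd0']
    refine add_le_add ?_ (error_le_betaCoef hd0 N n m _ fun t ℓ =>
      div_nonneg (sq_nonneg _) (hsum t).le)
    have := mul_le_mul_of_nonneg_left hσ
      (mul_nonneg (Qmin_nonneg d1 k d0 N n m) (by positivity : (0 : ℝ) ≤ d0 / d1))
    rw [hα]
    linarith
  refine (iterate_le_of_step hα0 hmono (haff _) hstep i x0).trans ?_
  gcongr
  rw [le_div_iff₀ (by linarith), geom_sum_mul_neg, pow_succ]
  nlinarith [pow_nonneg hα0 i]
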